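/- For every σ > 0 and ω₀ > 0, ∫₀^∞ |f_g(ω)|² dω − ∫₀^∞ |f_g(−ω)|² dω = 1. In particular ∫₀^∞ |f_g(ω)|² dω ≥ 1, so that the squeezing parameter θ_g = arccosh(√(∫₀^∞ |f_g(ω)|² dω)) is well defined, and cosh²(θ_g) − sinh²(θ_g) = 1 with cosh²(θ_g) = ∫₀^∞ |f_g(ω)|² dω and sinh²(θ_g) = ∫₀^∞ |f_g(−ω)|² dω. -/

import Mathlib

open MeasureTheory Real

/-- Squared modulus `|f_g(ω)|²` of the spectral amplitude of the subcycle Gaussian mode: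
`|f_g(ω)|² = (2π)^(−1/2) · (|ω|/(ω₀σ)) · exp(−(ω−ω₀)²/(2σ²))`. -/
noncomputable def fgSq (σ ω₀ ω : ℝ) : ℝ :=
  (1 / Real.sqrt (2 * Real.pi)) * (|ω| / (ω₀ * σ)) * Real.exp (-(ω - ω₀) ^ 2 / (2 * σ ^ 2))

/-- Inverse hyperbolic cosine, `arccosh x = log (x + √(x² − 1))`. -/
noncomputable def arccosh (x : ℝ) : ℝ := Real.log (x + Real.sqrt (x ^ 2 - 1))

/-- The signed density `sign ω * |f_g(ω)|²` is the Gaussian density of mean `ω₀` and standard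
deviation `σ`, weighted by `ω / ω₀`. -/
noncomputable def fgSigned (σ ω₀ ω : ℝ) : ℝ :=
  (1 / Real.sqrt (2 * Real.pi)) * (ω / (ω₀ * σ)) * Real.exp (-(ω - ω₀) ^ 2 / (2 * σ ^ 2))

theorem fgSq_nonneg {σ ω₀ : ℝ} (hσ : 0 < σ) (hω₀ : 0 < ω₀) (ω : ℝ) : 0 ≤ fgSq σ ω₀ ω := by
  unfold fgSq
  positivity

theorem fgSq_of_pos (σ ω₀ : ℝ) {ω : ℝ} (hω : 0 < ω) : fgSq σ ω₀ ω = fgSigned σ ω₀ ω := by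
  rw [fgSq, fgSigned, abs_of_pos hω]

theorem fgSq_neg_of_pos (σ ω₀ : ℝ) {ω : ℝ} (hω : 0 < ω) :
    fgSq σ ω₀ (-ω) = -fgSigned σ ω₀ (-ω) := by
  rw [fgSq, fgSigned, abs_neg, abs_of_pos hω]
  ring

theorem integral_fgSigned {σ ω₀ : ℝ} (hσ : 0 < σ) (hω₀ : 0 < ω₀) :
    ∫ ω, fgSigned σ ω₀ ω = 1 := by
  lift σ to NNReal using hσ.le
  have hv : σ ^ 2 ≠ 0 := pow_ne_zero 2 (NNReal.coe_pos.1 hσ).ne'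
  have h := ProbabilityTheory.integral_id_gaussianReal (μ := ω₀) (v := σ ^ 2)
  rw [ProbabilityTheory.integral_gaussianReal_eq_integral_smul hv] at h
  have hfun (ω : ℝ) : fgSigned σ ω₀ ω =
      ω₀⁻¹ * (ProbabilityTheory.gaussianPDFReal ω₀ (σ ^ 2) ω • ω) := by
    simp only [fgSigned, ProbabilityTheory.gaussianPDFReal_def, NNReal.coe_pow, smul_eq_mul]
    rw [Real.sqrt_mul (x := 2 * π) (by positivity), Real.sqrt_sq hσ.le]
    field_simp
  simp_rw [hfun]
  rw [integral_const_mul, h, inv_mul_cancel₀ hω₀.ne']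

/-- The positive-frequency weight exceeds the negative-frequency weight by one. -/
theorem integral_fgSq_sub_integral_fgSq_neg {σ ω₀ : ℝ} (hσ : 0 < σ) (hω₀ : 0 < ω₀) :
    (∫ ω in Set.Ioi (0 : ℝ), fgSq σ ω₀ ω) - (∫ ω in Set.Ioi (0 : ℝ), fgSq σ ω₀ (-ω)) = 1 := by
  have h1 := integral_fgSigned hσ hω₀
  have hint : Integrable (fgSigned σ ω₀) :=
    Integrable.of_integral_ne_zero (by rw [h1]; exact one_ne_zero)
  rw [setIntegral_congr_fun measurableSet_Ioi fun ω hω => fgSq_of_pos σ ω₀ hω,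
    setIntegral_congr_fun measurableSet_Ioi fun ω hω => fgSq_neg_of_pos σ ω₀ hω,
    integral_neg, integral_comp_neg_Ioi 0 (fgSigned σ ω₀), neg_zero, sub_neg_eq_add, add_comm,
    intervalIntegral.integral_Iic_add_Ioi hint.integrableOn hint.integrableOn, h1]

theorem cosh_arccosh_sqrt_sq {x : ℝ} (hx : 1 ≤ x) :
    Real.cosh (arccosh (Real.sqrt x)) ^ 2 = x := by
  change Real.cosh (Real.arcosh (Real.sqrt x)) ^ 2 = x
  rw [Real.cosh_arcosh (Real.one_le_sqrt.2 hx), Real.sq_sqrt (by linarith)]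

/-- The positive-frequency weight minus the negative-frequency weight of the Gaussian
mode is 1, the positive-frequency weight is at least 1 (so the squeezing parameter
`θ_g = arccosh(√(∫₀^∞ |f_g(ω)|² dω))` is well defined), and
`cosh²(θ_g) − sinh²(θ_g) = 1` with `cosh²(θ_g)` and `sinh²(θ_g)` equal to the
positive- and negative-frequency weights respectively. -/
theorem gaussian_mode_squeezing_parameter (σ ω₀ : ℝ) (hσ : 0 < σ) (hω₀ : 0 < ω₀) :
    (∫ ω in Set.Ioi (0 : ℝ), fgSq σ ω₀ ω) - (∫ ω in Set.Ioi (0 : ℝ), fgSq σ ω₀ (-ω)) = 1 ∧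
    1 ≤ ∫ ω in Set.Ioi (0 : ℝ), fgSq σ ω₀ ω ∧
    Real.cosh (arccosh (Real.sqrt (∫ ω in Set.Ioi (0 : ℝ), fgSq σ ω₀ ω))) ^ 2 =
      ∫ ω in Set.Ioi (0 : ℝ), fgSq σ ω₀ ω ∧
    Real.sinh (arccosh (Real.sqrt (∫ ω in Set.Ioi (0 : ℝ), fgSq σ ω₀ ω))) ^ 2 =
      ∫ ω in Set.Ioi (0 : ℝ), fgSq σ ω₀ (-ω) ∧
    Real.cosh (arccosh (Real.sqrt (∫ ω in Set.Ioi (0 : ℝ), fgSq σ ω₀ ω))) ^ 2 -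
      Real.sinh (arccosh (Real.sqrt (∫ ω in Set.Ioi (0 : ℝ), fgSq σ ω₀ ω))) ^ 2 = 1 := by
  have hsub := integral_fgSq_sub_integral_fgSq_neg hσ hω₀
  have hneg : 0 ≤ ∫ ω in Set.Ioi (0 : ℝ), fgSq σ ω₀ (-ω) :=
    integral_nonneg fun ω => fgSq_nonneg hσ hω₀ (-ω)
  have hone : 1 ≤ ∫ ω in Set.Ioi (0 : ℝ), fgSq σ ω₀ ω := by linarith
  have hcosh := cosh_arccosh_sqrt_sq hone
  refine ⟨hsub, hone, hcosh, ?_, Real.cosh_sq_sub_sinh_sq _⟩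
  rw [Real.sinh_sq, hcosh]
  linarith
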